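/- Let P, η̂, t̄, α be natural numbers with η̂ ≥ 1, t̄ ≥ 1, α > η̂, and η̂ not dividing α, and set Q = t̄ + ⌈α/η̂⌉, ν₂ = C(Q−1, Q−t̄−1), K = P·η̂, and γ = t̄/P as a real number. Suppose Q ≤ P and define N_M = ∑_{r=1}^{P} ∑_{c=1}^{P−Q+1} ∑_{m=1}^{η̂} ∑_{s=1}^{ν₂} C(P−c−1, Q−2). Then N_M = P·η̂·C(P−1, Q−1)·ν₂, and as real numbers, K·C(P−1, Q−1)·(η̂·t̄ + α)·ν₂ / N_M = K·γ + α. -/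

import Mathlib

theorem hockey_aux (q n : ℕ) :
    ∑ i ∈ Finset.range (n + 1), Nat.choose (n + q - i) q = Nat.choose (n + q + 1) (q + 1) := by
  induction n with
  | zero => simp
  | succ n ih =>
    rw [Finset.sum_range_succ']
    have h : ∀ i ∈ Finset.range (n + 1),
        Nat.choose (n + 1 + q - (i + 1)) q = Nat.choose (n + q - i) q := by
      intro i _
      congr 1
      omega
    rw [Finset.sum_congr rfl h, ih, show n + 1 + q + 1 = (n + q + 1) + 1 by ring,
      Nat.choose_succ_succ (n + q + 1) q, show n + 1 + q - 0 = n + q + 1 by omega, add_comm]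

theorem hockey_aux2 (P Q : ℕ) (hQ : 2 ≤ Q) (hQP : Q ≤ P) :
    ∑ c ∈ Finset.Icc 1 (P - Q + 1), Nat.choose (P - c - 1) (Q - 2)
      = Nat.choose (P - 1) (Q - 1) := by
  obtain ⟨q, rfl⟩ := Nat.exists_eq_add_of_le hQ
  obtain ⟨n, rfl⟩ := Nat.exists_eq_add_of_le hQP
  have h := hockey_aux q n
  rw [show 2 + q + n - 1 = n + q + 1 by omega, show 2 + q - 1 = q + 1 by omega, ← h,
    show 2 + q + n - (2 + q) + 1 = n + 1 by omega, Finset.range_eq_Ico,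
    ← Finset.Ico_add_one_right_eq_Icc, ← Finset.sum_Ico_add' _ 0 (n + 1) 1]
  refine Finset.sum_congr rfl fun i _ => ?_
  congr 1 <;> omega

/-- Remark 2, regime 3 (`α > η̂`, `α/η̂` non-integer, Strategy B, uniform association):
`N_M = Pη̂·C(P-1,Q-1)·ν₂` and `K·C(P-1,Q-1)·(η̂t̄+α)·ν₂ / N_M = Kγ + α`. -/
theorem remark2_regime3 (P etahat tbar α Q ν₂ K NM : ℕ)
    (heta : 1 ≤ etahat) (ht : 1 ≤ tbar) (halpha : etahat < α) (hnd : ¬ etahat ∣ α)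
    (hQ : Q = tbar + α ⌈/⌉ etahat) (hν : ν₂ = Nat.choose (Q - 1) (Q - tbar - 1))
    (hK : K = P * etahat) (hQP : Q ≤ P)
    (hNM : NM = ∑ r ∈ Finset.Icc 1 P, ∑ c ∈ Finset.Icc 1 (P - Q + 1),
        ∑ m ∈ Finset.Icc 1 etahat, ∑ s ∈ Finset.Icc 1 ν₂,
          Nat.choose (P - c - 1) (Q - 2)) :
    NM = P * etahat * Nat.choose (P - 1) (Q - 1) * ν₂
      ∧ ((K : ℝ) * ((P - 1).choose (Q - 1) : ℝ) * ((etahat : ℝ) * (tbar : ℝ) + (α : ℝ))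
            * (ν₂ : ℝ)) / (NM : ℝ)
          = (K : ℝ) * ((tbar : ℝ) / (P : ℝ)) + (α : ℝ) := by
  have hc : 2 ≤ α ⌈/⌉ etahat := by
    by_contra h
    have h1 : α ⌈/⌉ etahat ≤ 1 := by omega
    rw [ceilDiv_le_iff_le_mul (by omega)] at h1
    omega
  have h1 : NM = P * etahat * Nat.choose (P - 1) (Q - 1) * ν₂ := by
    rw [hNM, ← hockey_aux2 P Q (by omega) hQP]
    simp only [Finset.sum_const, Nat.card_Icc, smul_eq_mul, Nat.add_sub_cancel,
      ← Finset.mul_sum]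
    ring
  refine ⟨h1, ?_⟩
  have hP : (P : ℝ) ≠ 0 := by
    have : P ≠ 0 := by omega
    exact_mod_cast this
  have he : (etahat : ℝ) ≠ 0 := by
    have : etahat ≠ 0 := by omega
    exact_mod_cast this
  have hC : ((P - 1).choose (Q - 1) : ℝ) ≠ 0 := by
    have := Nat.choose_pos (n := P - 1) (k := Q - 1) (by omega)
    exact_mod_cast this.ne'
  have hv : (ν₂ : ℝ) ≠ 0 := by
    have := Nat.choose_pos (n := Q - 1) (k := Q - tbar - 1) (by omega)
    rw [← hν] at this
    exact_mod_cast this.ne'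
  rw [h1, hK]
  push_cast
  field_simp
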